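/- Let A_Z be a finite-dimensional factor and let A_AB, A_BC, A_B be subfactors of A_Z satisfying the commuting square condition E_AB ∘ E_BC = E_BC ∘ E_AB = E_B. Then for every state ψ on A_Z, the entropy Ŝ satisfies the strong subadditivity inequality Ŝ(ψ) − Ŝ(ψ|_{A_AB}) − Ŝ(ψ|_{A_BC}) + Ŝ(ψ|_{A_B}) ≤ 0. -/

import Mathlib

/- Statement 0: strong subadditivity of the entropy Ŝ for a commuting square of
finite-dimensional factors.

A finite-dimensional factor is modelled as a star-subalgebra of a full matrix algebra
`Mat N` with trivial center (`IsFactorSub`); `tau` is the tracial state; the density of a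
state ψ is `ρ` (positive, `tau ρ = 1`) and `Ŝ(ψ) = -τ(ρ log ρ)`.  The τ-preserving
conditional expectation onto `B` is characterized by `IsCondExp`.  The density of the
restriction of ψ to a subalgebra `B` is `E_B ρ`, so `Ŝ(ψ|_B) = Shat (E_B ρ)`. -/

open scoped ComplexOrder

abbrev Mat (N : ℕ) := Matrix (Fin N) (Fin N) ℂ

/-- The tracial state on the full matrix algebra. -/
noncomputable def tau {N : ℕ} (x : Mat N) : ℂ := x.trace / N

/-- Functional calculus logarithm of a (positive semidefinite) matrix. -/
noncomputable def mlog {N : ℕ} (x : Mat N) : Mat N := cfc Real.log x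

/-- The entropy `Ŝ(ψ) = -ψ(log ρ_ψ) = -τ(ρ log ρ)` of a state with τ-density `ρ`. -/
noncomputable def Shat {N : ℕ} (ρ : Mat N) : ℝ := -(tau (ρ * mlog ρ)).re

/-- `ρ` is the density (w.r.t. the tracial state `tau`) of a state. -/
def IsTauDensity {N : ℕ} (ρ : Mat N) : Prop := ρ.PosSemidef ∧ tau ρ = 1

/-- `E` is the τ-preserving conditional expectation onto the unital *-subalgebra `B`:
it maps into `B`, fixes `B` pointwise, and `τ(b x) = τ(b (E x))` for `b ∈ B`.
These properties determine `E` uniquely. -/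
def IsCondExp {N : ℕ} (B : StarSubalgebra ℂ (Mat N)) (E : Mat N →ₗ[ℂ] Mat N) : Prop :=
  (∀ x, E x ∈ B) ∧ (∀ b ∈ B, E b = b) ∧
    (∀ x : Mat N, ∀ b ∈ B, (b * x).trace = (b * E x).trace)

/-- `B` is a subfactor (trivial relative center in itself), i.e. a full matrix subalgebra. -/
def IsFactorSub {N : ℕ} (B : StarSubalgebra ℂ (Mat N)) : Prop :=
  ∀ x ∈ B, (∀ y ∈ B, x * y = y * x) → ∃ c : ℂ, x = c • (1 : Mat N)

/-- The commuting square condition: `B = AB ⊓ BC` and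
`E_AB ∘ E_BC = E_BC ∘ E_AB = E_B`. -/
def CommSquare {N : ℕ} (AB BC B : StarSubalgebra ℂ (Mat N))
    (EAB EBC EB : Mat N →ₗ[ℂ] Mat N) : Prop :=
  IsCondExp AB EAB ∧ IsCondExp BC EBC ∧ IsCondExp B EB ∧
    B = AB ⊓ BC ∧ (∀ x, EAB (EBC x) = EB x) ∧ (∀ x, EBC (EAB x) = EB x)

section Auxiliary

open Matrix

/-- The matrix `U diag(p) Uᴴ` with real spectrum `p`. -/
noncomputable def diagConj {N : ℕ} (U : Mat N) (p : Fin N → ℝ) : Mat N :=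
  U * diagonal (fun i => (p i : ℂ)) * Uᴴ

theorem Matrix.IsHermitian.exists_diagConj {N : ℕ} {A : Mat N} (hA : A.IsHermitian) :
    ∃ (U : Mat N) (p : Fin N → ℝ), Uᴴ * U = 1 ∧ U * Uᴴ = 1 ∧ A = diagConj U p ∧
      (∀ f : ℝ → ℝ, cfc f A = diagConj U (f ∘ p)) ∧ (A.PosDef → ∀ i, 0 < p i) ∧
      ((∀ i, 0 ≤ p i) → A.PosSemidef) := by
  refine ⟨hA.eigenvectorUnitary, hA.eigenvalues, ?_, ?_, ?_, fun f => ?_, fun h i => ?_,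
    hA.posSemidef_iff_eigenvalues_nonneg.mpr⟩
  · exact Unitary.coe_star_mul_self hA.eigenvectorUnitary
  · exact Unitary.coe_mul_star_self hA.eigenvectorUnitary
  · exact hA.spectral_theorem
  · rw [hA.cfc_eq]; rfl
  · exact h.eigenvalues_pos i

theorem trace_diagConj_mul {N : ℕ} (U V : Mat N) (p q : Fin N → ℝ) :
    (diagConj U q * diagConj V p).trace.re =
      ∑ j, ∑ i, Complex.normSq ((Uᴴ * V) j i) * (q j * p i) := by
  have h : (diagConj U q * diagConj V p).trace =
      (diagonal (fun i => (q i : ℂ)) * (Uᴴ * V) * diagonal (fun i => (p i : ℂ)) *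
        (Uᴴ * V)ᴴ).trace := by
    unfold diagConj
    rw [Matrix.mul_assoc, Matrix.mul_assoc, trace_mul_comm]
    simp only [conjTranspose_mul, conjTranspose_conjTranspose, Matrix.mul_assoc]
  rw [h]
  simp only [trace, diag_apply, mul_apply (N := (Uᴴ * V)ᴴ), mul_diagonal, diagonal_mul,
    conjTranspose_apply, Complex.re_sum]
  refine Finset.sum_congr rfl fun j _ => Finset.sum_congr rfl fun i _ => ?_
  simp [Complex.normSq_apply]
  ring

theorem diagConj_one {N : ℕ} {U : Mat N} (hU : U * Uᴴ = 1) : diagConj U (fun _ => 1) = 1 := by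
  simp [diagConj, hU]

theorem diagConj_mul {N : ℕ} {U : Mat N} (hU : Uᴴ * U = 1) (p q : Fin N → ℝ) :
    diagConj U p * diagConj U q = diagConj U (fun i => p i * q i) := by
  have : diagConj U p * diagConj U q = U * diagonal (fun i => (p i : ℂ)) * (Uᴴ * U) *
      diagonal (fun i => (q i : ℂ)) * Uᴴ := by
    simp only [diagConj, Matrix.mul_assoc]
  rw [this, hU, Matrix.mul_one, Matrix.mul_assoc U, diagonal_mul_diagonal]
  simp [diagConj]

theorem trace_diagConj {N : ℕ} {U : Mat N} (hU : Uᴴ * U = 1) (p : Fin N → ℝ) :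
    (diagConj U p).trace.re = ∑ i, p i := by
  rw [diagConj, trace_mul_comm, ← Matrix.mul_assoc, hU, Matrix.one_mul]
  simp [trace]

theorem StarSubalgebra.matrix_cfc_mem {N : ℕ} (B : StarSubalgebra ℂ (Mat N)) {a : Mat N}
    (ha : a ∈ B) (f : ℝ → ℝ) : cfc f a ∈ B := by
  have : IsClosed (B : Set (Mat N)) := B.toSubalgebra.toSubmodule.closed_of_finiteDimensional
  exact cfc_mem f ha

/-- For positive definite `ρ`, `σ`, the values `τ(ρ x)` at the solutions `x` of the Sylvester
equations `σ x + t x ρ = ρ` have an explicit antiderivative in `t ≥ 0`, which interpolates between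
`τ(ρ log σ)` at `t = 0` and `τ(ρ log ρ)` at infinity. -/
theorem exists_sylvester_potential {N : ℕ} {ρ σ : Mat N} (hρ : ρ.PosDef) (hσ : σ.PosDef) :
    ∃ Φ : ℝ → ℝ, Φ 0 = (mlog σ * ρ).trace.re ∧
      Filter.Tendsto (fun t => Φ t - ρ.trace.re * Real.log t) Filter.atTop
        (nhds (ρ * mlog ρ).trace.re) ∧
      ∀ t : ℝ, 0 ≤ t → ∃ x : Mat N, σ * x + (t : ℂ) • (x * ρ) = ρ ∧
        HasDerivAt Φ (ρ * x).trace.re t := by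
  obtain ⟨V, p, hV, hV', rfl, hVf, hp, -⟩ := hρ.1.exists_diagConj
  obtain ⟨U, q, hU, hU', rfl, hUf, hq, -⟩ := hσ.1.exists_diagConj
  replace hp := hp hρ
  replace hq := hq hσ
  have htr : (diagConj V p).trace.re = ∑ j, ∑ i, Complex.normSq ((Uᴴ * V) j i) * p i := by
    have := trace_diagConj_mul U V p (fun _ => 1)
    simpa [diagConj_one hU'] using this
  have hlog : (diagConj V p * mlog (diagConj V p)).trace.re =
      ∑ j, ∑ i, Complex.normSq ((Uᴴ * V) j i) * (p i * Real.log (p i)) := by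
    have := trace_diagConj_mul U V (fun i => p i * Real.log (p i)) (fun _ => 1)
    rw [diagConj_one hU', Matrix.one_mul] at this
    have h2 : diagConj V p * mlog (diagConj V p) = diagConj V (fun i => p i * Real.log (p i)) := by
      rw [mlog, hVf, diagConj_mul hV]
      rfl
    rw [h2, this]
    simp
  refine ⟨fun t => ∑ j, ∑ i, Complex.normSq ((Uᴴ * V) j i) * (p i * Real.log (q j + t * p i)),
    ?_, ?_, fun t ht => ?_⟩
  · rw [mlog, hUf, trace_diagConj_mul]
    simp [mul_comm]
  · rw [hlog, htr]
    simp only [Finset.sum_mul, ← Finset.sum_sub_distrib]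
    refine tendsto_finsetSum _ fun j _ => tendsto_finsetSum _ fun i _ => ?_
    have h1 : Filter.Tendsto (fun t : ℝ => Real.log (q j / t + p i)) Filter.atTop
        (nhds (Real.log (p i))) := by
      have h0 : Filter.Tendsto (fun t : ℝ => q j / t + p i) Filter.atTop (nhds (0 + p i)) :=
        (tendsto_const_nhds.div_atTop Filter.tendsto_id).add_const _
      rw [zero_add] at h0
      exact h0.log (hp i).ne'
    refine ((h1.const_mul (p i)).const_mul (Complex.normSq ((Uᴴ * V) j i))).congr' ?_
    filter_upwards [Filter.eventually_gt_atTop 0] with t ht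
    have h2 : q j + t * p i = t * (q j / t + p i) := by field_simp
    have h3 : 0 < q j / t + p i := add_pos (div_pos (hq j) ht) (hp i)
    rw [h2, Real.log_mul ht.ne' h3.ne']
    ring
  · have hpos : ∀ i j, 0 < q j + t * p i := fun i j =>
      add_pos_of_pos_of_nonneg (hq j) (mul_nonneg ht (hp i).le)
    set X : Mat N := Matrix.of fun j i => (Uᴴ * V) j i * (p i / (q j + t * p i) : ℝ) with hX
    have hXeq : diagonal (fun i => (q i : ℂ)) * X +
        (t : ℂ) • (X * diagonal (fun i => (p i : ℂ))) =
        Uᴴ * V * diagonal (fun i => (p i : ℂ)) := by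
      ext j i
      have : ((q j : ℂ) + t * p i) ≠ 0 := by exact_mod_cast (hpos i j).ne'
      simp only [hX, Matrix.add_apply, Matrix.smul_apply, diagonal_mul, mul_diagonal, of_apply,
        smul_eq_mul]
      push_cast
      field_simp
      exact mul_div_cancel_right₀ _ (by rwa [mul_comm (t : ℂ)] at this)
    refine ⟨U * X * Vᴴ, ?_, ?_⟩
    · have h1 : diagConj U q * (U * X * Vᴴ) = U * (diagonal (fun i => (q i : ℂ)) * X) * Vᴴ := by
        have : diagConj U q * (U * X * Vᴴ) =
            U * diagonal (fun i => (q i : ℂ)) * (Uᴴ * U) * X * Vᴴ := by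
          simp only [diagConj, Matrix.mul_assoc]
        rw [this, hU, Matrix.mul_one]
        simp only [Matrix.mul_assoc]
      have h2 : U * X * Vᴴ * diagConj V p = U * (X * diagonal (fun i => (p i : ℂ))) * Vᴴ := by
        have : U * X * Vᴴ * diagConj V p =
            U * X * (Vᴴ * V) * diagonal (fun i => (p i : ℂ)) * Vᴴ := by
          simp only [diagConj, Matrix.mul_assoc]
        rw [this, hV, Matrix.mul_one]
        simp only [Matrix.mul_assoc]
      rw [h1, h2, ← Matrix.smul_mul, ← Matrix.mul_smul, ← Matrix.add_mul, ← Matrix.mul_add, hXeq,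
        ← Matrix.mul_assoc, ← Matrix.mul_assoc, hU', Matrix.one_mul]
      rfl
    · have htrx : (diagConj V p * (U * X * Vᴴ)).trace.re =
          ∑ j, ∑ i, Complex.normSq ((Uᴴ * V) j i) * (p i * (p i / (q j + t * p i))) := by
        have : (diagConj V p * (U * X * Vᴴ)).trace =
            (X * (diagonal (fun i => (p i : ℂ)) * (Uᴴ * V)ᴴ)).trace := by
          have h1 : diagConj V p * (U * X * Vᴴ) =
              (V * diagonal (fun i => (p i : ℂ)) * (Uᴴ * V)ᴴ * X) * Vᴴ := by
            simp only [diagConj, conjTranspose_mul, conjTranspose_conjTranspose, Matrix.mul_assoc]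
          rw [h1, trace_mul_comm, ← Matrix.mul_assoc, ← Matrix.mul_assoc, ← Matrix.mul_assoc, hV,
            Matrix.one_mul, trace_mul_comm]
        rw [this]
        simp only [trace, diag_apply, mul_apply (M := X), diagonal_mul,
          conjTranspose_apply, Complex.re_sum]
        refine Finset.sum_congr rfl fun j _ => Finset.sum_congr rfl fun i _ => ?_
        have : X j i * ((p i : ℂ) * star ((Uᴴ * V) j i)) =
            ((Complex.normSq ((Uᴴ * V) j i) * (p i * (p i / (q j + t * p i))) : ℝ) : ℂ) := by
          rw [hX, of_apply, Complex.ofReal_mul, Complex.normSq_eq_conj_mul_self]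
          simp only [RCLike.star_def]
          push_cast
          ring
        rw [this, Complex.ofReal_re]
      rw [htrx]
      refine HasDerivAt.fun_sum fun j _ => HasDerivAt.fun_sum fun i _ => ?_
      have h := ((((hasDerivAt_id t).mul_const (p i)).const_add (q j)).log (hpos i j).ne')
      simpa using (h.const_mul (p i)).const_mul (Complex.normSq ((Uᴴ * V) j i))

/-- A solution `x` of the Sylvester equation `σ x + t x ρ = ρ` maximizes the quadratic functional
`y ↦ 2 Re Tr(ρ y) - Tr(yᴴ (σ y + t y ρ))`, with maximal value `Re Tr(ρ x)`. -/
theorem two_mul_re_trace_sub_le {N : ℕ} {ρ σ x : Mat N} {t : ℝ} (hρ : ρ.PosSemidef)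
    (hσ : σ.PosSemidef) (ht : 0 ≤ t) (hx : σ * x + (t : ℂ) • (x * ρ) = ρ) (y : Mat N) :
    2 * (ρ * y).trace.re - (yᴴ * (σ * y + (t : ℂ) • (y * ρ))).trace.re ≤ (ρ * x).trace.re := by
  have re_conj : ∀ a : Mat N, aᴴ.trace.re = a.trace.re := fun a => by
    simp [trace_conjTranspose]
  have hnn : 0 ≤ ((y - x)ᴴ * (σ * (y - x) + (t : ℂ) • ((y - x) * ρ))).trace.re := by
    have h1 := (Complex.le_def.mp (hσ.conjTranspose_mul_mul_same (y - x)).trace_nonneg).1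
    have h2 := (Complex.le_def.mp (hρ.mul_mul_conjTranspose_same (y - x)).trace_nonneg).1
    rw [Matrix.mul_add, Matrix.mul_smul, trace_add, trace_smul,
      trace_mul_comm _ ((y - x) * ρ), ← Matrix.mul_assoc]
    simp only [Complex.add_re, smul_eq_mul, Complex.re_ofReal_mul]
    exact add_nonneg h1 (mul_nonneg ht h2)
  have hsub : σ * (y - x) + (t : ℂ) • ((y - x) * ρ) = σ * y + (t : ℂ) • (y * ρ) - ρ := by
    conv_rhs => rw [← hx]
    rw [Matrix.mul_sub, Matrix.sub_mul, smul_sub, hx]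
    nth_rewrite 4 [← hx]
    abel
  have hxy : (xᴴ * (σ * y + (t : ℂ) • (y * ρ))).trace = (ρ * y).trace := by
    have : ρ = xᴴ * σ + (t : ℂ) • (ρ * xᴴ) := by
      have := congrArg conjTranspose hx
      rw [conjTranspose_add, conjTranspose_smul, conjTranspose_mul, conjTranspose_mul, hρ.1.eq,
        hσ.1.eq] at this
      simpa using this.symm
    conv_rhs => rw [this]
    rw [Matrix.mul_add, Matrix.add_mul, trace_add, trace_add, Matrix.mul_smul, Matrix.smul_mul,
      trace_smul, trace_smul, ← Matrix.mul_assoc, ← Matrix.mul_assoc, trace_mul_comm (xᴴ * y),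
      Matrix.mul_assoc ρ]
  have h1 : (yᴴ * ρ).trace.re = (ρ * y).trace.re := by
    rw [← re_conj, conjTranspose_mul, conjTranspose_conjTranspose, hρ.1.eq]
  have h2 : (xᴴ * ρ).trace.re = (ρ * x).trace.re := by
    rw [← re_conj, conjTranspose_mul, conjTranspose_conjTranspose, hρ.1.eq]
  rw [hsub, conjTranspose_sub, Matrix.sub_mul, Matrix.mul_sub, Matrix.mul_sub] at hnn
  simp only [trace_sub, Complex.sub_re, hxy, h1, h2] at hnn
  linarith

namespace IsCondExp

variable {N : ℕ} {B : StarSubalgebra ℂ (Mat N)} {E : Mat N →ₗ[ℂ] Mat N}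

theorem eq_of_trace_mul_eq {a b : Mat N} (ha : a ∈ B) (hb : b ∈ B)
    (h : ∀ c ∈ B, (c * a).trace = (c * b).trace) : a = b := by
  have h1 := h _ (star_mem (sub_mem ha hb))
  rw [← sub_eq_zero, ← trace_sub, ← Matrix.mul_sub, star_eq_conjTranspose,
    trace_conjTranspose_mul_self_eq_zero_iff, sub_eq_zero] at h1
  exact h1

theorem map_mul_left (hE : IsCondExp B E) {b : Mat N} (hb : b ∈ B) (x : Mat N) :
    E (b * x) = b * E x := by
  refine eq_of_trace_mul_eq (hE.1 _) (mul_mem hb (hE.1 _)) fun c hc => ?_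
  rw [← hE.2.2 _ _ hc, ← Matrix.mul_assoc, ← Matrix.mul_assoc, hE.2.2 _ _ (mul_mem hc hb)]

theorem map_mul_right (hE : IsCondExp B E) {b : Mat N} (hb : b ∈ B) (x : Mat N) :
    E (x * b) = E x * b := by
  refine eq_of_trace_mul_eq (hE.1 _) (mul_mem (hE.1 _) hb) fun c hc => ?_
  rw [← hE.2.2 _ _ hc, ← Matrix.mul_assoc, ← Matrix.mul_assoc, trace_mul_comm,
    trace_mul_comm _ b, ← Matrix.mul_assoc, ← Matrix.mul_assoc, hE.2.2 _ _ (mul_mem hb hc)]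

theorem isHermitian_map (hE : IsCondExp B E) {x : Mat N} (hx : x.IsHermitian) :
    (E x).IsHermitian := by
  refine eq_of_trace_mul_eq (star_mem (hE.1 _)) (hE.1 _) fun c hc => ?_
  have h1 := congrArg star (hE.2.2 x _ (star_mem hc))
  rw [← trace_conjTranspose, ← trace_conjTranspose, conjTranspose_mul, conjTranspose_mul,
    star_eq_conjTranspose, conjTranspose_conjTranspose, hx.eq] at h1
  rw [← hE.2.2 _ _ hc, trace_mul_comm, trace_mul_comm c]
  exact h1.symm

theorem posSemidef_map (hE : IsCondExp B E) {x : Mat N} (hx : x.PosSemidef) :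
    (E x).PosSemidef := by
  obtain ⟨U, p, hU, -, hEx, hf, -, hpos⟩ := (hE.isHermitian_map hx.1).exists_diagConj
  refine hpos fun i => ?_
  set b : Mat N := cfc (fun s : ℝ => max (-s) 0) (E x) with hb
  have hbB : b ∈ B := B.matrix_cfc_mem (hE.1 x) _
  have hbH : bᴴ = b := IsSelfAdjoint.star_eq (cfc_predicate _ (E x))
  have h1 : (bᴴ * x * b).trace = (b * b * E x).trace := by
    rw [hbH, trace_mul_comm, ← Matrix.mul_assoc, hE.2.2 _ _ (mul_mem hbB hbB)]
  have h2 := (Complex.le_def.mp (hx.conjTranspose_mul_mul_same b).trace_nonneg).1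
  rw [h1, hb, hf] at h2
  rw [hEx] at h2
  rw [diagConj_mul hU, diagConj_mul hU, trace_diagConj hU] at h2
  by_contra! hi
  have h3 : ∀ j ∈ Finset.univ, max (-p j) 0 * max (-p j) 0 * p j ≤ 0 := fun j _ => by
    rcases le_total 0 (p j) with h | h
    · simp [h]
    · exact mul_nonpos_of_nonneg_of_nonpos (mul_self_nonneg _) h
  have h4 : ∑ j, max (-p j) 0 * max (-p j) 0 * p j < 0 := by
    refine Finset.sum_neg' h3 ⟨i, Finset.mem_univ _, ?_⟩
    rw [max_eq_left (by linarith)]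
    exact mul_neg_of_pos_of_neg (mul_self_pos.mpr (by linarith)) hi
  exact h4.not_ge h2

/-- Monotonicity of the relative entropy under conditional expectations. -/
theorem relative_entropy_le (hE : IsCondExp B E) {ρ σ : Mat N} (hρ : ρ.PosDef) (hσ : σ.PosDef)
    (hρ' : (E ρ).PosDef) (hσ' : (E σ).PosDef) :
    (E ρ * mlog (E ρ)).trace.re - (mlog (E σ) * E ρ).trace.re ≤
      (ρ * mlog ρ).trace.re - (mlog σ * ρ).trace.re := by
  obtain ⟨Φ, hΦ0, hΦ, hΦd⟩ := exists_sylvester_potential hρ hσ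
  obtain ⟨Ψ, hΨ0, hΨ, hΨd⟩ := exists_sylvester_potential hρ' hσ'
  have key : ∀ t : ℝ, 0 ≤ t → ∃ d, 0 ≤ d ∧ HasDerivAt (fun s => Φ s - Ψ s) d t := by
    intro t ht
    obtain ⟨x, hx, hxd⟩ := hΦd t ht
    obtain ⟨x', hx', hxd'⟩ := hΨd t ht
    refine ⟨_, sub_nonneg.mpr ?_, hxd.sub hxd'⟩
    have hy : E x' ∈ B := hE.1 x'
    have hyx : E σ * E x' + (t : ℂ) • (E x' * E ρ) = E ρ := by
      have := congrArg E hx'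
      rwa [map_add, map_smul, hE.map_mul_left (hE.1 _), hE.map_mul_right (hE.1 _),
        hE.2.1 _ (hE.1 ρ)] at this
    have h := two_mul_re_trace_sub_le hρ.posSemidef hσ.posSemidef ht hx (E x')
    set y := E x' with hydef
    have h1 : (E ρ * x').trace = (E ρ * y).trace := hE.2.2 _ _ (hE.1 ρ)
    have h2 : (ρ * y).trace = (E ρ * y).trace := by
      rw [trace_mul_comm, hE.2.2 _ _ hy, trace_mul_comm]
    have hys : yᴴ ∈ B := star_mem hy
    have h3 : (yᴴ * (σ * y + (t : ℂ) • (y * ρ))).trace =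
        (yᴴ * (E σ * y + (t : ℂ) • (y * E ρ))).trace := by
      have e : ∀ a b : Mat N, (yᴴ * (a * y + (t : ℂ) • (y * b))).trace =
          (y * yᴴ * a).trace + (t : ℂ) * (yᴴ * y * b).trace := fun a b => by
        rw [Matrix.mul_add, trace_add, Matrix.mul_smul, trace_smul, ← Matrix.mul_assoc,
          trace_mul_comm, ← Matrix.mul_assoc, ← Matrix.mul_assoc, smul_eq_mul]
      rw [e, e, hE.2.2 _ _ (mul_mem hy hys), hE.2.2 _ _ (mul_mem hys hy)]
    have h4 : (yᴴ * E ρ).trace.re = (E ρ * y).trace.re := by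
      have := trace_conjTranspose (E ρ * y)
      rw [conjTranspose_mul, hρ'.1.eq] at this
      simp [this]
    rw [h3, hyx, h4, h2] at h
    rw [h1]
    linarith
  have hmono : MonotoneOn (fun s => Φ s - Ψ s) (Set.Ici 0) := by
    refine monotoneOn_of_deriv_nonneg (convex_Ici 0) (fun t ht => ?_) (fun t ht => ?_)
      fun t ht => ?_
    · obtain ⟨d, -, hd⟩ := key t ht
      exact hd.continuousAt.continuousWithinAt
    · obtain ⟨d, -, hd⟩ := key t (interior_subset ht)
      exact hd.differentiableAt.differentiableWithinAt
    · obtain ⟨d, hd0, hd⟩ := key t (interior_subset ht)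
      rwa [hd.deriv]
  have htr : (E ρ).trace = ρ.trace := by
    simpa using (hE.2.2 ρ 1 (one_mem B)).symm
  have hlim : Filter.Tendsto (fun t => Φ t - Ψ t) Filter.atTop
      (nhds ((ρ * mlog ρ).trace.re - (E ρ * mlog (E ρ)).trace.re)) := by
    refine (hΦ.sub hΨ).congr fun t => ?_
    rw [htr]
    ring
  have hle : Φ 0 - Ψ 0 ≤ (ρ * mlog ρ).trace.re - (E ρ * mlog (E ρ)).trace.re := by
    refine ge_of_tendsto hlim ?_
    filter_upwards [Filter.eventually_ge_atTop 0] with t ht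
    exact hmono Set.self_mem_Ici ht ht
  rw [hΦ0, hΨ0] at hle
  linarith

theorem trace_mlog_map_mul (hE : IsCondExp B E) (x : Mat N) :
    (mlog (E x) * x).trace = (E x * mlog (E x)).trace := by
  rw [hE.2.2 x (mlog (E x)) (B.matrix_cfc_mem (hE.1 x) _), trace_mul_comm]

end IsCondExp

theorem Matrix.PosSemidef.add_smul_one {N : ℕ} {x : Mat N} (hx : x.PosSemidef) {ε : ℝ}
    (hε : 0 < ε) : (x + (ε : ℂ) • (1 : Mat N)).PosDef :=
  PosDef.posSemidef_add hx (PosDef.one.smul (by exact_mod_cast hε))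

/-- The entropy is continuous in the direction of the identity. -/
theorem tendsto_Shat_add_smul_one {N : ℕ} {x : Mat N} (hx : x.IsHermitian) :
    Filter.Tendsto (fun ε : ℝ => Shat (x + (ε : ℂ) • (1 : Mat N))) (nhdsWithin 0 (Set.Ioi 0))
      (nhds (Shat x)) := by
  obtain ⟨U, p, hU, -, -, hf, -⟩ := hx.exists_diagConj
  have hcont : ∀ (f : ℝ → ℝ) (y : Mat N), ContinuousOn f (spectrum ℝ y) := fun f y =>
    y.finite_real_spectrum.continuousOn f
  have hS : ∀ ε : ℝ, Shat (x + (ε : ℂ) • (1 : Mat N)) =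
      -((∑ i, (p i + ε) * Real.log (p i + ε)) / N) := by
    intro ε
    have hxs : IsSelfAdjoint x := hx
    have h1 : x + (ε : ℂ) • (1 : Mat N) = cfc (fun s : ℝ => s + ε) x := by
      rw [cfc_add_const ε (fun s => s) x (hcont _ _), cfc_id' ℝ x, Algebra.algebraMap_eq_smul_one]
      rfl
    have h2 : mlog (x + (ε : ℂ) • (1 : Mat N)) = cfc (fun s : ℝ => Real.log (s + ε)) x := by
      rw [mlog, h1, ← cfc_comp' Real.log (fun s : ℝ => s + ε) x
        ((Set.Finite.image _ x.finite_real_spectrum).continuousOn _) (hcont _ _)]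
    rw [Shat, tau, h2, h1, hf, hf, diagConj_mul hU, Complex.div_natCast_re, trace_diagConj hU]
    rfl
  have h0 : Shat x = -((∑ i, (p i + 0) * Real.log (p i + 0)) / N) := by
    rw [← hS 0]; simp
  rw [h0]
  simp only [hS]
  have hc : Continuous fun ε : ℝ => -((∑ i, (p i + ε) * Real.log (p i + ε)) / N) :=
    ((continuous_finsetSum _ fun i _ => Real.continuous_mul_log.comp
      (continuous_const.add continuous_id)).div_const _).neg
  exact (hc.tendsto 0).mono_left nhdsWithin_le_nhds

end Auxiliary

/-- Strong subadditivity of the entropy `Ŝ` for any state of a finite-dimensional factor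
with subfactors forming a commuting square. -/
theorem stmt0 {N : ℕ} (hN : 0 < N) (AB BC B : StarSubalgebra ℂ (Mat N))
    (hABf : IsFactorSub AB) (hBCf : IsFactorSub BC) (hBf : IsFactorSub B)
    (EAB EBC EB : Mat N →ₗ[ℂ] Mat N)
    (hsq : CommSquare AB BC B EAB EBC EB)
    (ρ : Mat N) (hρ : IsTauDensity ρ) :
    Shat ρ - Shat (EAB ρ) - Shat (EBC ρ) + Shat (EB ρ) ≤ 0 := by
  obtain ⟨hAB, hBC, hB, rfl, -, hcomm⟩ := hsq
  have hψ := hρ.1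
  have hlim := (((tendsto_Shat_add_smul_one hψ.1).sub
    (tendsto_Shat_add_smul_one (hAB.isHermitian_map hψ.1))).sub
    (tendsto_Shat_add_smul_one (hBC.isHermitian_map hψ.1))).add
    (tendsto_Shat_add_smul_one (hB.isHermitian_map hψ.1))
  refine le_of_tendsto hlim ?_
  filter_upwards [self_mem_nhdsWithin] with ε hε
  have hmap : ∀ {C : StarSubalgebra ℂ (Mat N)} {E : Mat N →ₗ[ℂ] Mat N}, IsCondExp C E →
      E ρ + (ε : ℂ) • (1 : Mat N) = E (ρ + (ε : ℂ) • (1 : Mat N)) := fun {C E} hE => by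
    rw [map_add, map_smul, hE.2.1 1 (one_mem C)]
  have hpos : ∀ {C : StarSubalgebra ℂ (Mat N)} {E : Mat N →ₗ[ℂ] Mat N}, IsCondExp C E →
      (E (ρ + (ε : ℂ) • (1 : Mat N))).PosDef := fun {C E} hE => by
    rw [← hmap hE]
    exact (hE.posSemidef_map hψ).add_smul_one hε
  rw [hmap hAB, hmap hBC, hmap hB]
  set r := ρ + (ε : ℂ) • (1 : Mat N)
  have h := hBC.relative_entropy_le (hψ.add_smul_one hε) (hpos hAB) (hpos hBC)
    (by rw [hcomm]; exact hpos hB)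
  have hlogB : (mlog (EB r) * EBC r).trace = (EB r * mlog (EB r)).trace := by
    rw [← hB.trace_mlog_map_mul r]
    exact (hBC.2.2 _ _ ((AB ⊓ BC).matrix_cfc_mem (hB.1 r) _).2).symm
  rw [hcomm, hAB.trace_mlog_map_mul, hlogB] at h
  have hN' : (0 : ℝ) < N := by exact_mod_cast hN
  have h' := div_le_div_of_nonneg_right h hN'.le
  simp only [Shat, tau, Complex.div_natCast_re]
  rw [sub_div, sub_div] at h'
  linarith
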